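/- Let s be a weak composition, T an s-decreasing tree, and (a,b), (c,d) tree ascents of T with a < c. Let Z and Q be the s-tree rotations of T along (a,b) and (c,d) respectively. Then Z and Q are the only atoms of the closed interval [T, Z ∨ Q] in s-weak order, i.e., the only elements covering T in that interval. -/

import Mathlib

open scoped Classical

/-- An `s`-decreasing tree with internal vertices `1,…,n` (the root is `n`), encoded by
recording, for each non-root internal vertex `v`, its parent `parent v` (an internal vertex
with a larger label, so that labels decrease away from the root) and the index `idx v` of
the child slot of `parent v` (among `0,…,s (parent v)`, left to right) containing `v`.
Distinct internal vertices occupy distinct child slots; all remaining slots are leaves. -/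
structure SDecTree (n : ℕ) (s : ℕ → ℕ) where
  parent : ℕ → ℕ
  idx : ℕ → ℕ
  parent_gt : ∀ v, 1 ≤ v → v < n → v < parent v
  parent_le : ∀ v, 1 ≤ v → v < n → parent v ≤ n
  idx_le : ∀ v, 1 ≤ v → v < n → idx v ≤ s (parent v)
  slot_inj : ∀ v w, 1 ≤ v → v < n → 1 ≤ w → w < n →
      parent v = parent w → idx v = idx w → v = w
  parent_out : ∀ v, v = 0 ∨ n ≤ v → parent v = 0
  idx_out : ∀ v, v = 0 ∨ n ≤ v → idx v = 0

namespace SDecTree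

variable {n : ℕ} {s : ℕ → ℕ}

/-- `y` is a weak ancestor of `x`, i.e. `x` is a labeled vertex of the subtree `T^y`. -/
def Descend (T : SDecTree n s) (x y : ℕ) : Prop :=
  ∃ k, T.parent^[k] x = y ∧ ∀ m ≤ k, 1 ≤ T.parent^[m] x ∧ T.parent^[m] x ≤ n

/-- `x` is a labeled vertex of the subtree `T^y_j` rooted at the `j`-th child of `y`. -/
def InSub (T : SDecTree n s) (y j x : ℕ) : Prop :=
  ∃ c, T.Descend x c ∧ T.parent c = y ∧ T.idx c = j

/-- `x` lies strictly left of `y` in the planar tree `T`. -/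
def LeftOf (T : SDecTree n s) (x y : ℕ) : Prop :=
  ∃ z j₁ j₂, j₁ < j₂ ∧ T.InSub z j₁ x ∧ T.InSub z j₂ y

/-- The cardinality `#_T(y,x)` of the pair `(y,x)`: it is `j` if `x ∈ T^y_j`
(so `0` if `x ∈ T^y_0` and `s y` if `x ∈ T^y_{s y}`), `0` if `x` is left of `y`, and
`s y` if `x` is right of `y`; it is `0` for out-of-range pairs. -/
noncomputable def card (T : SDecTree n s) (y x : ℕ) : ℕ :=
  if h : ∃ j, T.InSub y j x then h.choose
  else if 1 ≤ x ∧ x < y ∧ y ≤ n ∧ ¬ T.LeftOf x y then s y else 0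

/-- `x` is a labeled vertex of `T^a ∖ 0`, i.e. of `T^a` with `T^a_0` replaced by a leaf. -/
def InSubMinus0 (T : SDecTree n s) (a x : ℕ) : Prop :=
  x = a ∨ ∃ j, 0 < j ∧ T.InSub a j x

/-- `(a,b)` is a tree ascent of `T`. -/
def TreeAscent (T : SDecTree n s) (a b : ℕ) : Prop :=
  1 ≤ a ∧ a < b ∧ b ≤ n ∧
  (∃ i, i < s b ∧ T.InSub b i a) ∧
  (∀ e j, a < e → e < b → T.InSub e j a → j = s e) ∧
  (0 < s a → ∀ x, ¬ T.InSub a (s a) x)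

end SDecTree

/-- A multi-inversion set (encoded by its multiplicity function) is transitive:
if `a < b < c` then `#(b,a) = 0` or `#(c,a) ≥ #(c,b)`. -/
def IsTransitiveInv (I : ℕ → ℕ → ℕ) : Prop :=
  ∀ a b c, a < b → b < c → I b a = 0 ∨ I c b ≤ I c a

/-- The transitive closure of a multi-inversion set: the smallest (by inclusion, i.e.
pointwise on multiplicities) transitive multi-inversion set containing it. -/
noncomputable def tcInv (I : ℕ → ℕ → ℕ) : ℕ → ℕ → ℕ := fun y x =>
  sInf {m | ∃ J : ℕ → ℕ → ℕ, IsTransitiveInv J ∧ (∀ y' x', I y' x' ≤ J y' x') ∧ J y x = m}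

/-- Add one copy of the inversion `(b,a)` to `I`, capping the multiplicity at `s b`. -/
def addInv (s : ℕ → ℕ) (I : ℕ → ℕ → ℕ) (b a : ℕ) : ℕ → ℕ → ℕ := fun y x =>
  if y = b ∧ x = a then min (I y x + 1) (s y) else I y x

namespace SDecTree

variable {n : ℕ} {s : ℕ → ℕ}

/-- The `s`-weak order: `T ⪯ Z` iff `#_T(y,x) ≤ #_Z(y,x)` for all pairs. -/
def wle (T Z : SDecTree n s) : Prop := ∀ y x, T.card y x ≤ Z.card y x

/-- Strict `s`-weak order. -/
def wlt (T Z : SDecTree n s) : Prop := wle T Z ∧ ¬ wle Z T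

/-- Cover relation in the `s`-weak order. -/
def wcov (T Z : SDecTree n s) : Prop := wlt T Z ∧ ∀ U, wlt T U → wlt U Z → False

/-- `W` is the join of `T` and `Z` in the `s`-weak order. -/
def IsJoin (T Z W : SDecTree n s) : Prop :=
  wle T W ∧ wle Z W ∧ ∀ U, wle T U → wle Z U → wle W U

/-- `Z` is the `s`-tree rotation of `T` along the tree ascent `(a,b)`, i.e.
`inv Z = (inv T + (b,a))^tc`. -/
def IsRotation (T Z : SDecTree n s) (a b : ℕ) : Prop :=
  T.TreeAscent a b ∧
  ∀ y x, 1 ≤ x → x < y → y ≤ n → Z.card y x = tcInv (addInv s T.card b a) y x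

/-- The set `A_T(a,b)` of inversions added by a rotation producing `Z`: the pairs `(f,e)`
with `#_Z(f,e) > #_T(f,e)`. -/
def Aset (T Z : SDecTree n s) : Set (ℕ × ℕ) :=
  {p | T.card p.1 p.2 < Z.card p.1 p.2}

/-- The set `A_T(a,b)` described directly via the transitive closure. -/
def ARot (T : SDecTree n s) (a b : ℕ) : Set (ℕ × ℕ) :=
  {p | T.card p.1 p.2 < tcInv (addInv s T.card b a) p.1 p.2}

/-- The set `F_T(a,c)` (here `b` and `d` are the partners of `a` and `c` in the
respective tree ascents `(a,b)` and `(c,d)`): it is `{(d,e) : e ∈ T^a∖0}` if `b = c`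
and `a ∈ T^c_0`, and empty otherwise. -/
def Fset (T : SDecTree n s) (a b c d : ℕ) : Set (ℕ × ℕ) :=
  {p | b = c ∧ T.InSub c 0 a ∧ p.1 = d ∧ T.InSubMinus0 a p.2}

/-- `T` is an `s`-Tamari tree: `#_T(c,a) ≤ #_T(c,b)` whenever `a < b < c`. -/
def IsTamari (T : SDecTree n s) : Prop :=
  ∀ a b c, a < b → b < c → T.card c a ≤ T.card c b

/-- `(a,b)` is a Tamari tree ascent of `T`: `a` is a non-rightmost child of `b`. -/
def TamariAscent (T : SDecTree n s) (a b : ℕ) : Prop :=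
  1 ≤ a ∧ a < n ∧ T.parent a = b ∧ T.card b a < s b

/-- `Z` is the `s`-Tamari rotation of `T` along the Tamari tree ascent `(a,b)`. -/
def IsTamRotation (T Z : SDecTree n s) (a b : ℕ) : Prop :=
  T.TamariAscent a b ∧
  ∀ y x, 1 ≤ x → x < y → y ≤ n → Z.card y x = tcInv (addInv s T.card b a) y x

/-- Cover relation in the `s`-Tamari lattice. -/
def tamcov (T Z : SDecTree n s) : Prop :=
  IsTamari T ∧ IsTamari Z ∧ wlt T Z ∧ ∀ U, IsTamari U → wlt T U → wlt U Z → False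

/-- `W` is the join of `T` and `Z` in the `s`-Tamari lattice. -/
def IsTamJoin (T Z W : SDecTree n s) : Prop :=
  IsTamari W ∧ wle T W ∧ wle Z W ∧ ∀ U, IsTamari U → wle T U → wle Z U → wle W U

/-- The open interval `(T,Z)` in the `s`-weak order. -/
def OpenInterval (T Z : SDecTree n s) : Set (SDecTree n s) := {U | wlt T U ∧ wlt U Z}

/-- A set of trees forming a chain in the `s`-weak order. -/
def IsChainSet (C : Set (SDecTree n s)) : Prop :=
  C.Pairwise fun U V => wlt U V ∨ wlt V U

/-- The geometric realization of the order complex `Δ(T,Z)` of the open interval `(T,Z)`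
in the `s`-weak order: the space of finitely supported probability vectors on the vertex
set whose support is a chain of the open interval. -/
def orderComplex (T Z : SDecTree n s) : Set (SDecTree n s → ℝ) :=
  {f | (∀ U, 0 ≤ f U) ∧ (Function.support f).Finite ∧
    Function.support f ⊆ OpenInterval T Z ∧ IsChainSet (Function.support f) ∧
    ∑ᶠ U, f U = 1}

/-- The geometric realization of the order complex of the open interval `(T,Z)` in the
`s`-Tamari lattice. -/
def tamOrderComplex (T Z : SDecTree n s) : Set (SDecTree n s → ℝ) :=
  {f | (∀ U, 0 ≤ f U) ∧ (Function.support f).Finite ∧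
    Function.support f ⊆ {U | IsTamari U ∧ wlt T U ∧ wlt U Z} ∧
    IsChainSet (Function.support f) ∧ ∑ᶠ U, f U = 1}

end SDecTree

/-- The list of labels of the consecutive cover relations along a saturated chain,
recorded as a list of poset elements. -/
def labelsOf {α : Type*} (lab : α → α → ℕ) (L : List α) : List ℕ :=
  (L.zip L.tail).map fun p => lab p.1 p.2


/-! ### Tree layer -/

namespace SDecTree

variable {n : ℕ} {s : ℕ → ℕ}

theorem Descend.range {T : SDecTree n s} {x y : ℕ} (h : T.Descend x y) :
    1 ≤ x ∧ x ≤ n ∧ 1 ≤ y ∧ y ≤ n := by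
  obtain ⟨k, hk, hm⟩ := h
  have h0 := hm 0 (Nat.zero_le _)
  have h1 := hm k le_rfl
  rw [hk] at h1
  exact ⟨h0.1, h0.2, h1.1, h1.2⟩

theorem Descend.refl {T : SDecTree n s} {x : ℕ} (h1 : 1 ≤ x) (h2 : x ≤ n) : T.Descend x x :=
  ⟨0, rfl, fun m hm => by
    obtain rfl : m = 0 := by omega
    exact ⟨h1, h2⟩⟩

theorem Descend.head {T : SDecTree n s} {x y : ℕ} (h1 : 1 ≤ x) (h2 : x ≤ n)
    (h : T.Descend (T.parent x) y) : T.Descend x y := by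
  obtain ⟨k, hk, hm⟩ := h
  refine ⟨k + 1, by simpa using hk, ?_⟩
  intro m hmk
  cases m with
  | zero => exact ⟨h1, h2⟩
  | succ m => simpa using hm m (by omega)

theorem Descend.cases {T : SDecTree n s} {x y : ℕ} (h : T.Descend x y) :
    x = y ∨ (x < n ∧ T.Descend (T.parent x) y) := by
  have hr := h.range
  obtain ⟨k, hk, hm⟩ := h
  cases k with
  | zero => left; simpa using hk
  | succ k =>
    right
    have h1 := hm 1 (by omega)
    refine ⟨?_, k, by simpa using hk, fun m hmk => by simpa using hm (m + 1) (by omega)⟩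
    by_contra hc
    have := T.parent_out x (Or.inr (by omega))
    simp [this] at h1

theorem Descend.ind {T : SDecTree n s} {y : ℕ} {P : ℕ → Prop} (h0 : P y)
    (hs : ∀ x, 1 ≤ x → x < n → T.Descend (T.parent x) y → P (T.parent x) → P x) :
    ∀ x, T.Descend x y → P x := by
  have key : ∀ m x, n - x ≤ m → T.Descend x y → P x := by
    intro m
    induction m with
    | zero =>
      intro x hx h
      have hr := h.range
      rcases h.cases with rfl | ⟨h1, h2⟩
      · exact h0
      · omega
    | succ m ih =>
      intro x hx h
      have hr := h.range
      rcases h.cases with rfl | ⟨h1, h2⟩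
      · exact h0
      · have := T.parent_gt x hr.1 h1
        exact hs x hr.1 h1 h2 (ih _ (by omega) h2)
  exact fun x h => key _ x le_rfl h

theorem Descend.le {T : SDecTree n s} {x y : ℕ} (h : T.Descend x y) : x ≤ y := by
  refine Descend.ind (P := fun x => x ≤ y) le_rfl ?_ x h
  intro x h1 h2 _ h4
  have := T.parent_gt x h1 h2
  omega

theorem Descend.trans {T : SDecTree n s} {x y z : ℕ} (h : T.Descend x y) (h' : T.Descend y z) :
    T.Descend x z := by
  refine Descend.ind (P := fun x => T.Descend x z) h' ?_ x h
  intro x h1 h2 _ h4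
  exact h4.head h1 h2.le

theorem Descend.total {T : SDecTree n s} {x y z : ℕ} (h : T.Descend x y) :
    T.Descend x z → (T.Descend y z ∨ T.Descend z y) := by
  refine Descend.ind (P := fun x => T.Descend x z → (T.Descend y z ∨ T.Descend z y))
    (fun h => Or.inl h) ?_ x h
  intro x h1 h2 h3 h4 h5
  rcases h5.cases with rfl | ⟨_, h6⟩
  · exact Or.inr (h3.head h1 h2.le)
  · exact h4 h6

theorem Descend.of_le {T : SDecTree n s} {x y z : ℕ} (h : T.Descend x y) (h' : T.Descend x z)
    (hyz : y ≤ z) : T.Descend y z := by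
  rcases h.total h' with h1 | h1
  · exact h1
  · obtain rfl : y = z := le_antisymm hyz h1.le
    exact h1

theorem Descend.root {T : SDecTree n s} {x : ℕ} (h1 : 1 ≤ x) (h2 : x ≤ n) : T.Descend x n := by
  have key : ∀ m x, n - x ≤ m → 1 ≤ x → x ≤ n → T.Descend x n := by
    intro m
    induction m with
    | zero =>
      intro x hx h1 h2
      obtain rfl : x = n := by omega
      exact Descend.refl h1 h2
    | succ m ih =>
      intro x hx h1 h2
      rcases Nat.eq_or_lt_of_le h2 with rfl | h3
      · exact Descend.refl h1 h2
      · have := T.parent_gt x h1 h3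
        have := T.parent_le x h1 h3
        exact (ih _ (by omega) (by omega) (by omega)).head h1 h2
  exact key _ x le_rfl h1 h2

theorem Descend.child {T : SDecTree n s} {x y : ℕ} (h : T.Descend x y) :
    x = y ∨ ∃ c, T.Descend x c ∧ c < n ∧ T.parent c = y := by
  refine Descend.ind (P := fun x => x = y ∨ ∃ c, T.Descend x c ∧ c < n ∧ T.parent c = y)
    (Or.inl rfl) ?_ x h
  intro x h1 h2 h3 h4
  right
  rcases h4 with h4 | ⟨c, h5, h6, h7⟩
  · exact ⟨x, Descend.refl h1 h2.le, h2, h4⟩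
  · exact ⟨c, h5.head h1 h2.le, h6, h7⟩

theorem Descend.inSub {T : SDecTree n s} {x y : ℕ} (h : T.Descend x y) (hxy : x < y) :
    ∃ j, T.InSub y j x := by
  rcases h.child with rfl | ⟨c, h1, _, h3⟩
  · omega
  · exact ⟨_, c, h1, h3, rfl⟩

theorem InSub.range {T : SDecTree n s} {x y j : ℕ} (h : T.InSub y j x) (hy : 1 ≤ y) :
    1 ≤ x ∧ x < y ∧ y ≤ n ∧ T.Descend x y ∧ j ≤ s y := by
  obtain ⟨c, h1, h2, h3⟩ := h
  have hr := h1.range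
  have hc : c < n := by
    by_contra hc
    have := T.parent_out c (Or.inr (by omega))
    omega
  have h4 := T.parent_gt c hr.2.2.1 hc
  have h5 := T.parent_le c hr.2.2.1 hc
  have h6 := T.idx_le c hr.2.2.1 hc
  rw [h2] at h4 h5 h6
  have := h1.le
  refine ⟨hr.1, by omega, h5, h1.trans ?_, by omega⟩
  exact Descend.head hr.2.2.1 hr.2.2.2 (by rw [h2]; exact Descend.refl hy h5)

theorem InSub.uniq {T : SDecTree n s} {x y j j' : ℕ} (h : T.InSub y j x) (h' : T.InSub y j' x) :
    j = j' := by
  have aux : ∀ c c', T.parent c = y → T.parent c' = y → T.Descend c c' → c = c' := by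
    intro c c' h1 h2 h3
    rcases h3.cases with h4 | ⟨_, h5⟩
    · exact h4
    · exfalso
      have hr := h5.range
      have hle := h5.le
      have hc' : c' < n := by
        by_contra hc
        have := T.parent_out c' (Or.inr (by omega))
        omega
      have := T.parent_gt c' hr.2.2.1 hc'
      omega
  obtain ⟨c, h1, h2, h3⟩ := h
  obtain ⟨c', h1', h2', h3'⟩ := h'
  have : c = c' := by
    rcases h1.total h1' with h | h
    · exact aux _ _ h2 h2' h
    · exact (aux _ _ h2' h2 h).symm
  subst this
  omega

theorem InSub.desc {T : SDecTree n s} {x y z j : ℕ} (h : T.InSub y j z) (h' : T.Descend x z) :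
    T.InSub y j x := by
  obtain ⟨c, h1, h2, h3⟩ := h
  exact ⟨c, h'.trans h1, h2, h3⟩

theorem InSub.up {T : SDecTree n s} {x y z j : ℕ} (h : T.InSub y j x) (h' : T.Descend x z)
    (hz : z < y) : T.InSub y j z := by
  have hr := h.range (by omega)
  obtain ⟨j', h1⟩ := (h'.of_le hr.2.2.2.1 hz.le).inSub hz
  have := h.uniq (h1.desc h')
  subst this
  exact h1

theorem card_of_inSub {T : SDecTree n s} {x y j : ℕ} (h : T.InSub y j x) : T.card y x = j := by
  have hex : ∃ j, T.InSub y j x := ⟨j, h⟩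
  unfold card
  rw [dif_pos hex]
  exact hex.choose_spec.uniq h

theorem LeftOf.pos {T : SDecTree n s} {x y : ℕ} (h : T.LeftOf x y) :
    ∃ z j₁ j₂, j₁ < j₂ ∧ T.InSub z j₁ x ∧ T.InSub z j₂ y ∧ 1 ≤ z := by
  obtain ⟨z, j₁, j₂, h1, h2, h3⟩ := h
  refine ⟨z, j₁, j₂, h1, h2, h3, ?_⟩
  by_contra hz
  obtain ⟨c, h4, h5, h6⟩ := h3
  have hr := h4.range
  by_cases hc : c < n
  · have := T.parent_gt c hr.2.2.1 hc
    omega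
  · have := T.idx_out c (Or.inr (by omega))
    omega

theorem LeftOf.not_desc {T : SDecTree n s} {x y : ℕ} (h : T.LeftOf x y ∨ T.LeftOf y x) :
    ¬ T.Descend x y := by
  intro hd
  rcases h with h | h
  · obtain ⟨z, j₁, j₂, h1, h2, h3, h4⟩ := h.pos
    have := h2.uniq (h3.desc hd)
    omega
  · obtain ⟨z, j₁, j₂, h1, h2, h3, h4⟩ := h.pos
    have := h3.uniq (h2.desc hd)
    omega

theorem LeftOf.trans {T : SDecTree n s} {x y z : ℕ} (h : T.LeftOf x y) (h' : T.LeftOf y z) :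
    T.LeftOf x z := by
  obtain ⟨u, i₁, i₂, h1, h2, h3, h4⟩ := h.pos
  obtain ⟨v, j₁, j₂, k1, k2, k3, k4⟩ := h'.pos
  have hu := h3.range h4
  have hv := k2.range k4
  rcases lt_trichotomy u v with huv | rfl | huv
  · refine ⟨v, j₁, j₂, k1, ?_, k3⟩
    exact (k2.up hu.2.2.2.1 huv).desc (h2.range h4).2.2.2.1
  · have := h3.uniq k2
    exact ⟨u, i₁, j₂, by omega, h2, k3⟩
  · refine ⟨u, i₁, i₂, h1, h2, ?_⟩
    exact (h3.up hv.2.2.2.1 huv).desc (k3.range k4).2.2.2.1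

theorem LeftOf.asymm {T : SDecTree n s} {x y : ℕ} (h : T.LeftOf x y) (h' : T.LeftOf y x) :
    False := by
  obtain ⟨z, j₁, j₂, h1, h2, h3, h4⟩ := (h.trans h').pos
  have := h2.uniq h3
  omega

theorem card_of_left {T : SDecTree n s} {x y : ℕ} (hy : 1 ≤ y) (h : T.LeftOf x y) :
    T.card y x = 0 := by
  have hex : ¬ ∃ j, T.InSub y j x := by
    rintro ⟨j, hj⟩
    exact LeftOf.not_desc (Or.inl h) (hj.range hy).2.2.2.1
  unfold card
  rw [dif_neg hex, if_neg]
  tauto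

theorem card_of_right {T : SDecTree n s} {x y : ℕ} (hx : 1 ≤ x) (hxy : x < y) (hy : y ≤ n)
    (h : T.LeftOf y x) : T.card y x = s y := by
  have hex : ¬ ∃ j, T.InSub y j x := by
    rintro ⟨j, hj⟩
    exact LeftOf.not_desc (Or.inr h) (hj.range (by omega)).2.2.2.1
  unfold card
  rw [dif_neg hex, if_pos]
  exact ⟨hx, hxy, hy, fun h' => h.asymm h'⟩

theorem card_out {T : SDecTree n s} {x y : ℕ} (h : ¬ (1 ≤ x ∧ x < y ∧ y ≤ n)) :
    T.card y x = 0 := by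
  by_cases hex : ∃ j, T.InSub y j x
  · obtain ⟨j, hj⟩ := hex
    rw [card_of_inSub hj]
    by_cases hy : 1 ≤ y
    · have := hj.range hy
      tauto
    · obtain ⟨c, h4, h5, h6⟩ := hj
      have hr := h4.range
      by_cases hc : c < n
      · have := T.parent_gt c hr.2.2.1 hc
        omega
      · have := T.idx_out c (Or.inr (by omega))
        omega
  · unfold card
    rw [dif_neg hex, if_neg]
    tauto

theorem tricho (T : SDecTree n s) {x y : ℕ} (hx : 1 ≤ x) (hxy : x < y) (hy : y ≤ n) :
    T.Descend x y ∨ T.LeftOf x y ∨ T.LeftOf y x := by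
  by_contra hcon
  push Not at hcon
  obtain ⟨h0, h1, h2⟩ := hcon
  have hex : ∃ z, T.Descend x z ∧ T.Descend y z :=
    ⟨n, Descend.root hx (by omega), Descend.root (by omega) hy⟩
  obtain ⟨h3, h4⟩ := Nat.find_spec hex
  have hmin := fun m => Nat.find_min hex (m := m)
  set z := Nat.find hex
  have hyz : y < z := by
    rcases Nat.eq_or_lt_of_le h4.le with h | h
    · exact absurd (h ▸ h3) h0
    · exact h
  rcases h3.child with h | ⟨u, hu1, hu2, hu3⟩
  · omega
  rcases h4.child with h | ⟨v, hv1, hv2, hv3⟩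
  · omega
  have hur := hu1.range
  have hvr := hv1.range
  have hne : T.idx u ≠ T.idx v := by
    intro hh
    have := T.slot_inj u v hur.2.2.1 hu2 hvr.2.2.1 hv2 (by omega) hh
    subst this
    have hlt := T.parent_gt u hur.2.2.1 hu2
    exact hmin u (by omega) ⟨hu1, hv1⟩
  rcases lt_or_gt_of_ne hne with h | h
  · exact h1 ⟨z, _, _, h, ⟨u, hu1, hu3, rfl⟩, ⟨v, hv1, hv3, rfl⟩⟩
  · exact h2 ⟨z, _, _, h, ⟨v, hv1, hv3, rfl⟩, ⟨u, hu1, hu3, rfl⟩⟩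

theorem card_le (T : SDecTree n s) (y x : ℕ) : T.card y x ≤ s y := by
  by_cases h : 1 ≤ x ∧ x < y ∧ y ≤ n
  · obtain ⟨h1, h2, h3⟩ := h
    rcases T.tricho h1 h2 h3 with h | h | h
    · obtain ⟨j, hj⟩ := h.inSub h2
      rw [card_of_inSub hj]
      exact (hj.range (by omega)).2.2.2.2
    · rw [card_of_left (by omega) h]; omega
    · rw [card_of_right h1 h2 h3 h]
  · rw [card_out h]; omega

theorem card_desc {T : SDecTree n s} {x y z : ℕ} (h : T.Descend x y) (hyz : y < z) (hz : z ≤ n) :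
    T.card z x = T.card z y := by
  have hr := h.range
  have hle := h.le
  rcases T.tricho hr.2.2.1 hyz hz with h1 | h1 | h1
  · obtain ⟨j, hj⟩ := h1.inSub hyz
    rw [card_of_inSub hj, card_of_inSub (hj.desc h)]
  · rw [card_of_left (by omega) h1, card_of_left (by omega)]
    obtain ⟨w, j₁, j₂, k1, k2, k3⟩ := h1
    exact ⟨w, j₁, j₂, k1, k2.desc h, k3⟩
  · rw [card_of_right hr.2.2.1 hyz hz h1, card_of_right hr.1 (by omega) hz]
    obtain ⟨w, j₁, j₂, k1, k2, k3⟩ := h1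
    exact ⟨w, j₁, j₂, k1, k2, k3.desc h⟩

/-- Left-to-right monotonicity of `card z ·`. -/
theorem card_mono {T : SDecTree n s} {x y z : ℕ} (h : T.LeftOf x y) (hx : 1 ≤ x) (hy : 1 ≤ y)
    (hxz : x < z) (hyz : y < z) (hz : z ≤ n) : T.card z x ≤ T.card z y := by
  rcases T.tricho hx hxz hz with h1 | h1 | h1
  · rcases T.tricho hy hyz hz with h2 | h2 | h2
    · obtain ⟨w, j₁, j₂, k1, k2, k3, k4⟩ := h.pos
      have hr2 := k2.range k4
      have hr3 := k3.range k4
      rcases lt_trichotomy z w with hw | rfl | hw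
      · have e1 := k2.up h1 hw
        have e2 := k3.up h2 hw
        have := e1.uniq e2
        omega
      · rw [card_of_inSub k2, card_of_inSub k3]; omega
      · rw [card_desc hr2.2.2.2.1 hw hz, card_desc hr3.2.2.2.1 hw hz]
    · exfalso
      obtain ⟨w, j₁, j₂, k1, k2, k3⟩ := h2
      exact h.asymm ⟨w, j₁, j₂, k1, k2, k3.desc h1⟩
    · rw [card_of_right hy hyz hz h2]; exact T.card_le _ _
  · rw [card_of_left (by omega) h1]; omega
  · rw [card_of_right hy hyz hz (h1.trans h)]; exact T.card_le _ _

end SDecTree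

/-! ### Tree-inversion functions -/

/-- Tree-inversion functions: bounded, transitive, planar. -/
structure GoodInv (n : ℕ) (s : ℕ → ℕ) (I : ℕ → ℕ → ℕ) : Prop where
  le : ∀ y x, I y x ≤ s y
  tr : ∀ x y z, 1 ≤ x → x < y → y < z → z ≤ n → I y x = 0 ∨ I z y ≤ I z x
  pl : ∀ x y z, 1 ≤ x → x < y → y < z → z ≤ n → I y x = s y ∨ I z x ≤ I z y

/-- Descendance read off an inversion function. -/
def DescInv (n : ℕ) (I : ℕ → ℕ → ℕ) (x y : ℕ) : Prop :=
  ∀ z, y < z → z ≤ n → I z x = I z y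

theorem DescInv.of_le {n : ℕ} {I : ℕ → ℕ → ℕ} {x y z : ℕ} (h : DescInv n I x y)
    (h' : DescInv n I x z) (hyz : y ≤ z) : DescInv n I y z := by
  intro w h1 h2
  rw [← h' w h1 h2, h w (by omega) h2]

theorem DescInv.trans {n : ℕ} {I : ℕ → ℕ → ℕ} {x y z : ℕ} (h : DescInv n I x y)
    (h' : DescInv n I y z) (hyz : y ≤ z) : DescInv n I x z := by
  intro w h1 h2
  rw [h w (by omega) h2, h' w h1 h2]

theorem GoodInv.meet {n : ℕ} {s : ℕ → ℕ} {I : ℕ → ℕ → ℕ} (hI : GoodInv n s I) {x y : ℕ}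
    (hx : 1 ≤ x) (hxy : x < y) (h : ¬ DescInv n I x y) :
    ∃ z, y < z ∧ z ≤ n ∧ I z x ≠ I z y ∧ DescInv n I x z ∧ DescInv n I y z := by
  unfold DescInv at h
  push Not at h
  obtain ⟨z0, hz0⟩ := h
  let P : ℕ → Prop := fun z => y < z ∧ z ≤ n ∧ I z x ≠ I z y
  have hP : P z0 := hz0
  have hspec : P (Nat.findGreatest P n) := Nat.findGreatest_spec hP.2.1 hP
  have hmax : ∀ w, Nat.findGreatest P n < w → w ≤ n → ¬ P w :=
    fun w h1 h2 => Nat.findGreatest_is_greatest h1 h2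
  set z := Nat.findGreatest P n
  have heq : ∀ w, z < w → w ≤ n → I w x = I w y := by
    intro w h1 h2
    by_contra h3
    exact hmax w h1 h2 ⟨by have := hspec.1; omega, h2, h3⟩
  obtain ⟨h1, h2, h3⟩ := hspec
  have hD : DescInv n I x z := by
    intro t ht htn
    by_contra hne
    have e := heq t ht htn
    have t1 := hI.tr x z t hx (by omega) ht htn
    have t2 := hI.tr y z t (by omega) (by omega) ht htn
    have p1 := hI.pl x z t hx (by omega) ht htn
    have p2 := hI.pl y z t (by omega) (by omega) ht htn
    omega
  refine ⟨z, h1, h2, h3, hD, ?_⟩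
  intro t ht htn
  rw [← heq t ht htn, hD t ht htn]

namespace SDecTree

variable {n : ℕ} {s : ℕ → ℕ}

theorem card_good (T : SDecTree n s) : GoodInv n s T.card where
  le := T.card_le
  tr := by
    intro x y z hx hxy hyz hz
    rcases T.tricho hx hxy (by omega) with h | h | h
    · right; rw [card_desc h hyz hz]
    · left; exact card_of_left (by omega) h
    · right; exact card_mono h (by omega) hx hyz (by omega) hz
  pl := by
    intro x y z hx hxy hyz hz
    rcases T.tricho hx hxy (by omega) with h | h | h
    · right; rw [card_desc h hyz hz]
    · right; exact card_mono h hx (by omega) (by omega) hyz hz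
    · left; exact card_of_right hx hxy (by omega) h

theorem card_trans (T : SDecTree n s) : IsTransitiveInv T.card := by
  intro x y z hxy hyz
  by_cases h : 1 ≤ x ∧ z ≤ n
  · exact T.card_good.tr x y z h.1 hxy hyz h.2
  · by_cases hz : z ≤ n
    · left; exact card_out (by tauto)
    · right; rw [card_out (by tauto)]; omega

theorem desc_iff (T : SDecTree n s) {x y : ℕ} (hx : 1 ≤ x) (hxy : x < y) (hy : y ≤ n) :
    T.Descend x y ↔ DescInv n T.card x y := by
  constructor
  · intro h z h1 h2
    exact card_desc h h1 h2
  · intro h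
    rcases T.tricho hx hxy hy with h1 | h1 | h1
    · exact h1
    · exfalso
      obtain ⟨w, j₁, j₂, k1, k2, k3, k4⟩ := h1.pos
      have hr := k3.range k4
      have := h w hr.2.1 hr.2.2.1
      rw [card_of_inSub k2, card_of_inSub k3] at this
      omega
    · exfalso
      obtain ⟨w, j₁, j₂, k1, k2, k3, k4⟩ := h1.pos
      have hr := k2.range k4
      have := h w hr.2.1 hr.2.2.1
      rw [card_of_inSub k2, card_of_inSub k3] at this
      omega

theorem inSub_iff (T : SDecTree n s) {x y j : ℕ} (hx : 1 ≤ x) (hxy : x < y) (hy : y ≤ n) :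
    T.InSub y j x ↔ DescInv n T.card x y ∧ T.card y x = j := by
  rw [← T.desc_iff hx hxy hy]
  constructor
  · intro h
    exact ⟨(h.range (by omega)).2.2.2.1, card_of_inSub h⟩
  · rintro ⟨h1, h2⟩
    obtain ⟨j', hj'⟩ := h1.inSub hxy
    rw [card_of_inSub hj'] at h2
    exact h2 ▸ hj'

/-- A tree is determined by its cardinalities. -/
theorem wle_antisymm {T U : SDecTree n s} (h : wle T U) (h' : wle U T) : T = U := by
  have hc : ∀ y x, T.card y x = U.card y x := fun y x => le_antisymm (h y x) (h' y x)
  have hc' : T.card = U.card := by funext y x; exact hc y x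
  have hdesc : ∀ x y, 1 ≤ x → x < y → y ≤ n → (T.Descend x y ↔ U.Descend x y) := by
    intro x y h1 h2 h3
    rw [T.desc_iff h1 h2 h3, U.desc_iff h1 h2 h3, hc']
  have pd : ∀ (A : SDecTree n s) v, 1 ≤ v → v < n → A.Descend v (A.parent v) := by
    intro A v h1 h2
    have := A.parent_gt v h1 h2
    have := A.parent_le v h1 h2
    exact Descend.head h1 h2.le (Descend.refl (by omega) (by omega))
  have pmin : ∀ (A : SDecTree n s) v y, v < y → A.Descend v y → A.parent v ≤ y := by
    intro A v y h1 h2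
    rcases h2.cases with h3 | ⟨_, h3⟩
    · omega
    · exact h3.le
  have hpar : ∀ v, 1 ≤ v → v < n → T.parent v = U.parent v := by
    intro v h1 h2
    apply le_antisymm
    · exact pmin T v _ (U.parent_gt v h1 h2)
        ((hdesc v _ h1 (U.parent_gt v h1 h2) (U.parent_le v h1 h2)).2 (pd U v h1 h2))
    · exact pmin U v _ (T.parent_gt v h1 h2)
        ((hdesc v _ h1 (T.parent_gt v h1 h2) (T.parent_le v h1 h2)).1 (pd T v h1 h2))
  have hidx : ∀ (A : SDecTree n s) v, 1 ≤ v → v < n → A.card (A.parent v) v = A.idx v := by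
    intro A v h1 h2
    exact card_of_inSub ⟨v, Descend.refl h1 h2.le, rfl, rfl⟩
  have e1 : T.parent = U.parent := by
    funext v
    by_cases hv : 1 ≤ v ∧ v < n
    · exact hpar v hv.1 hv.2
    · rw [T.parent_out v (by omega), U.parent_out v (by omega)]
  have e2 : T.idx = U.idx := by
    funext v
    by_cases hv : 1 ≤ v ∧ v < n
    · rw [← hidx T v hv.1 hv.2, ← hidx U v hv.1 hv.2, hc', e1]
    · rw [T.idx_out v (by omega), U.idx_out v (by omega)]
  cases T
  cases U
  simp only at e1 e2
  subst e1
  subst e2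
  rfl

end SDecTree

/-! ### From inversion functions to trees -/

section Build

variable {n : ℕ} {s : ℕ → ℕ} {I : ℕ → ℕ → ℕ}

theorem par_exists (n : ℕ) (I : ℕ → ℕ → ℕ) (v : ℕ) (h : v < n) :
    ∃ y, v < y ∧ y ≤ n ∧ DescInv n I v y :=
  ⟨n, h, le_rfl, fun z h1 h2 => by omega⟩

noncomputable def parInv (n : ℕ) (I : ℕ → ℕ → ℕ) (v : ℕ) : ℕ :=
  if h : 1 ≤ v ∧ v < n then Nat.find (par_exists n I v h.2) else 0

theorem parInv_spec {v : ℕ} (h : 1 ≤ v ∧ v < n) :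
    v < parInv n I v ∧ parInv n I v ≤ n ∧ DescInv n I v (parInv n I v) := by
  unfold parInv
  rw [dif_pos h]
  exact Nat.find_spec (par_exists n I v h.2)

theorem parInv_min {v y : ℕ} (h : 1 ≤ v ∧ v < n) (h1 : v < y) (h2 : y ≤ n)
    (h3 : DescInv n I v y) : parInv n I v ≤ y := by
  unfold parInv
  rw [dif_pos h]
  exact Nat.find_min' _ ⟨h1, h2, h3⟩

theorem slot_aux (hI : GoodInv n s I) {v w : ℕ} (hv : 1 ≤ v) (hw : w < n) (hvw : v < w)
    (h1 : parInv n I v = parInv n I w)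
    (h2 : I (parInv n I v) v = I (parInv n I w) w) : False := by
  have sv := parInv_spec (I := I) (n := n) (v := v) ⟨hv, by omega⟩
  have sw := parInv_spec (I := I) (n := n) (v := w) ⟨by omega, hw⟩
  by_cases hd : DescInv n I v w
  · have := parInv_min ⟨hv, by omega⟩ hvw hw.le hd
    omega
  · obtain ⟨z, k1, k2, k3, k4, k5⟩ := hI.meet hv hvw hd
    have m1 := parInv_min ⟨by omega, hw⟩ k1 k2 k5
    rcases Nat.eq_or_lt_of_le m1 with e | e
    · rw [h1, e] at h2
      exact k3 h2
    · have a1 := sv.2.2 z (by omega) k2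
      have a2 := sw.2.2 z e k2
      rw [h1] at a1
      omega

noncomputable def buildTree (hI : GoodInv n s I) : SDecTree n s where
  parent := parInv n I
  idx := fun v => if 1 ≤ v ∧ v < n then I (parInv n I v) v else 0
  parent_gt := fun v h1 h2 => (parInv_spec ⟨h1, h2⟩).1
  parent_le := fun v h1 h2 => (parInv_spec ⟨h1, h2⟩).2.1
  idx_le := fun v h1 h2 => by
    rw [if_pos ⟨h1, h2⟩]; exact hI.le _ _
  slot_inj := by
    intro v w h1 h2 h3 h4 h5 h6
    rw [if_pos ⟨h1, h2⟩, if_pos ⟨h3, h4⟩] at h6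
    rcases lt_trichotomy v w with h | h | h
    · exact (slot_aux hI h1 h4 h h5 h6).elim
    · exact h
    · exact (slot_aux hI h3 h2 h h5.symm h6.symm).elim
  parent_out := fun v h => by
    unfold parInv
    rw [dif_neg]; omega
  idx_out := fun v h => by
    rw [if_neg]; omega

theorem build_desc (hI : GoodInv n s I) {x y : ℕ} (h : (buildTree hI).Descend x y) :
    DescInv n I x y := by
  refine SDecTree.Descend.ind (P := fun x => DescInv n I x y) (fun _ _ _ => rfl) ?_ x h
  intro x h1 h2 h3 h4
  exact (parInv_spec ⟨h1, h2⟩).2.2.trans h4 h3.le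

theorem build_desc' (hI : GoodInv n s I) {y : ℕ} (hy : y ≤ n) :
    ∀ m x, y - x ≤ m → 1 ≤ x → x ≤ y → DescInv n I x y → (buildTree hI).Descend x y := by
  intro m
  induction m with
  | zero =>
    intro x hm h1 h2 _
    obtain rfl : x = y := by omega
    exact SDecTree.Descend.refl h1 hy
  | succ m ih =>
    intro x hm h1 h2 h3
    rcases Nat.eq_or_lt_of_le h2 with rfl | h4
    · exact SDecTree.Descend.refl h1 hy
    · have hr : 1 ≤ x ∧ x < n := ⟨h1, by omega⟩
      have sp := parInv_spec (I := I) hr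
      have mi := parInv_min hr h4 hy h3
      exact SDecTree.Descend.head h1 (by omega)
        (ih (parInv n I x) (by omega) (by omega) mi (sp.2.2.of_le h3 mi))

theorem build_inSub (hI : GoodInv n s I) {x y : ℕ} (hx : 1 ≤ x) (hxy : x < y) (hy : y ≤ n)
    (h : DescInv n I x y) : (buildTree hI).InSub y (I y x) x := by
  rcases (build_desc' hI hy _ x le_rfl hx hxy.le h).child with h1 | ⟨c, h1, h2, h3⟩
  · omega
  · refine ⟨c, h1, h3, ?_⟩
    have hr := h1.range
    have hp : parInv n I c = y := h3
    have hlt := (parInv_spec (I := I) (n := n) (v := c) ⟨hr.2.2.1, h2⟩).1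
    change (if 1 ≤ c ∧ c < n then I (parInv n I c) c else 0) = _
    rw [if_pos ⟨hr.2.2.1, h2⟩, hp]
    exact (build_desc hI h1 y (by omega) hy).symm

theorem build_card (hI : GoodInv n s I) {x y : ℕ} (hx : 1 ≤ x) (hxy : x < y) (hy : y ≤ n) :
    (buildTree hI).card y x = I y x := by
  by_cases hd : DescInv n I x y
  · exact SDecTree.card_of_inSub (build_inSub hI hx hxy hy hd)
  · obtain ⟨z, k1, k2, k3, k4, k5⟩ := hI.meet hx hxy hd
    have i1 := build_inSub hI hx (by omega) k2 k4
    have i2 := build_inSub hI (by omega) k1 k2 k5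
    rcases lt_or_gt_of_ne k3 with h | h
    · rw [SDecTree.card_of_left (by omega) ⟨z, _, _, h, i1, i2⟩]
      have := hI.tr x y z hx hxy k1 k2
      omega
    · rw [SDecTree.card_of_right hx hxy hy ⟨z, _, _, h, i2, i1⟩]
      have := hI.pl x y z hx hxy k1 k2
      omega

end Build

/-! ### Ascents -/

/-- Tree ascents read off an inversion function. -/
structure AscInv (n : ℕ) (s : ℕ → ℕ) (I : ℕ → ℕ → ℕ) (a b : ℕ) : Prop where
  pos : 1 ≤ a
  lt : a < b
  le : b ≤ n
  desc : DescInv n I a b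
  card : I b a < s b
  mid : ∀ e, a < e → e < b → DescInv n I a e → I e a = s e
  leaf : 0 < s a → ∀ x, 1 ≤ x → x < a → DescInv n I x a → I a x ≠ s a

theorem ascent_iff {n : ℕ} {s : ℕ → ℕ} (T : SDecTree n s) (a b : ℕ) :
    T.TreeAscent a b ↔ AscInv n s T.card a b := by
  constructor
  · rintro ⟨h1, h2, h3, ⟨i, h4, h5⟩, h6, h7⟩
    rw [T.inSub_iff h1 h2 h3] at h5
    refine ⟨h1, h2, h3, h5.1, by omega, ?_, ?_⟩
    · intro e k1 k2 k3
      exact h6 e _ k1 k2 ((T.inSub_iff h1 k1 (by omega)).2 ⟨k3, rfl⟩)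
    · intro k0 x k1 k2 k3 k4
      exact h7 k0 x ((T.inSub_iff k1 k2 (by omega)).2 ⟨k3, k4⟩)
  · intro h
    have := h.pos
    have := h.lt
    have := h.le
    refine ⟨h.pos, h.lt, h.le, ⟨_, h.card, (T.inSub_iff h.pos h.lt h.le).2 ⟨h.desc, rfl⟩⟩, ?_, ?_⟩
    · intro e j k1 k2 k3
      rw [T.inSub_iff h.pos k1 (by omega)] at k3
      rw [← k3.2]
      exact h.mid e k1 k2 k3.1
    · intro k0 x k1
      have hr := k1.range (by omega)
      rw [T.inSub_iff hr.1 hr.2.1 hr.2.2.1] at k1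
      exact h.leaf k0 x hr.1 hr.2.1 k1.1 k1.2

theorem AscInv.uniq {n : ℕ} {s : ℕ → ℕ} {I : ℕ → ℕ → ℕ} {a b b' : ℕ}
    (h : AscInv n s I a b) (h' : AscInv n s I a b') : b = b' := by
  rcases lt_trichotomy b b' with hb | hb | hb
  · have := h'.mid b h.lt hb h.desc
    have := h.card
    omega
  · exact hb
  · have := h.mid b' h'.lt hb h'.desc
    have := h'.card
    omega

/-- Lemma A: a strictly larger tree has more inversions at some ascent. -/
theorem exists_ascent {n : ℕ} {s : ℕ → ℕ} {I K : ℕ → ℕ → ℕ} (hI : GoodInv n s I)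
    (hK : GoodInv n s K) (hle : ∀ y x, I y x ≤ K y x)
    (hlt : ∃ y x, 1 ≤ x ∧ x < y ∧ y ≤ n ∧ I y x < K y x) :
    ∃ e f, AscInv n s I e f ∧ I f e < K f e := by
  -- the largest lower element of a differing pair
  obtain ⟨x, hx1, hxn, ⟨y, hxy, hyn, hy⟩, hmax⟩ : ∃ x, 1 ≤ x ∧ x ≤ n ∧
      (∃ y, x < y ∧ y ≤ n ∧ I y x < K y x) ∧
      ∀ x' y, x < x' → x' < y → y ≤ n → K y x' = I y x' := by
    obtain ⟨y0, x0, h1, h2, h3, h4⟩ := hlt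
    let P : ℕ → Prop := fun x => 1 ≤ x ∧ ∃ y, x < y ∧ y ≤ n ∧ I y x < K y x
    have hP : P x0 := ⟨h1, y0, h2, h3, h4⟩
    have hspec : P (Nat.findGreatest P n) := Nat.findGreatest_spec (by omega) hP
    refine ⟨Nat.findGreatest P n, hspec.1, Nat.findGreatest_le n, hspec.2, ?_⟩
    intro x' y k1 k2 k3
    have hn : ¬ P x' := Nat.findGreatest_is_greatest k1 (by omega)
    by_contra hne
    have := hle y x'
    exact hn ⟨by omega, y, k2, k3, by omega⟩
  -- move to an ancestor
  obtain ⟨z, hxz, hzn, hz, hDz⟩ : ∃ z, x < z ∧ z ≤ n ∧ I z x < K z x ∧ DescInv n I x z := by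
    by_cases hD : DescInv n I x y
    · exact ⟨y, hxy, hyn, hy, hD⟩
    · obtain ⟨z, k1, k2, k3, k4, k5⟩ := hI.meet hx1 hxy hD
      refine ⟨z, by omega, k2, ?_, k4⟩
      have t1 := hI.tr x y z hx1 hxy k1 k2
      have p1 := hI.pl x y z hx1 hxy k1 k2
      have t2 := hK.tr x y z hx1 hxy k1 k2
      have e1 := hmax y z hxy k1 k2
      have := hle z x
      have := hK.le y x
      omega
  -- lowest ancestor where `x` is not rightmost
  have hex : ∃ f, x < f ∧ f ≤ n ∧ DescInv n I x f ∧ I f x < s f :=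
    ⟨z, hxz, hzn, hDz, lt_of_lt_of_le hz (hK.le _ _)⟩
  obtain ⟨h1, h2, h3, h4⟩ := Nat.find_spec hex
  have hmin := fun m => Nat.find_min hex (m := m)
  have hfz : Nat.find hex ≤ z := Nat.find_min' hex ⟨hxz, hzn, hDz, lt_of_lt_of_le hz (hK.le _ _)⟩
  set f := Nat.find hex
  have hmid : ∀ e, x < e → e < f → DescInv n I x e → I e x = s e := by
    intro e k1 k2 k3
    by_contra hne
    have := hI.le e x
    exact hmin e k2 ⟨k1, by omega, k3, by omega⟩
  have hKf : I f x < K f x := by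
    rcases Nat.eq_or_lt_of_le hfz with e | e
    · rw [e]; exact hz
    · have e1 := h3 z e hzn
      have e2 := hmax f z h1 e hzn
      have p := hK.pl x f z hx1 h1 e hzn
      omega
  -- now minimize the lower element
  have hex2 : ∃ e, 1 ≤ e ∧ e < f ∧ DescInv n I e f ∧ I f e < K f e ∧
      ∀ g, e < g → g < f → DescInv n I e g → I g e = s g := ⟨x, hx1, h1, h3, hKf, hmid⟩
  obtain ⟨g1, g2, g3, g4, g5⟩ := Nat.find_spec hex2
  have hmin2 := fun m => Nat.find_min hex2 (m := m)
  set e := Nat.find hex2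
  refine ⟨e, f, ⟨g1, g2, h2, g3, lt_of_lt_of_le g4 (hK.le _ _), g5, ?_⟩, g4⟩
  intro hs x0 k1 k2 k3 k4
  let P : ℕ → Prop := fun c => 1 ≤ c ∧ c < e ∧ DescInv n I c e ∧ I e c = s e
  have hP : P x0 := ⟨k1, k2, k3, k4⟩
  have hspec : P (Nat.findGreatest P e) := Nat.findGreatest_spec k2.le hP
  have hgr : ∀ w, Nat.findGreatest P e < w → w ≤ e → ¬ P w :=
    fun w h1 h2 => Nat.findGreatest_is_greatest h1 h2
  set c := Nat.findGreatest P e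
  obtain ⟨c1, c2, c3, c4⟩ := hspec
  refine hmin2 c c2 ⟨c1, by omega, c3.trans g3 g2.le, ?_, ?_⟩
  · have t := hK.tr c e f c1 c2 g2 h2
    have := hle e c
    have := c3 f g2 h2
    omega
  · intro g l1 l2 l3
    rcases lt_trichotomy g e with h | h | h
    · exfalso
      refine hgr g l1 h.le ⟨by omega, h, l3.of_le c3 h.le, ?_⟩
      rw [← l3 e h (by omega)]; exact c4
    · rw [h]; exact c4
    · rw [c3 g h (by omega)]
      exact g5 g h l2 (c3.of_le l3 h.le)

/-! ### The maximal function avoiding an ascent -/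

/-- The lower-or-left part of the labels strictly between `e` and `f`, together with `e`. -/
def LPart (s : ℕ → ℕ) (I : ℕ → ℕ → ℕ) (e f x : ℕ) : Prop :=
  x = e ∨ (e < x ∧ x < f ∧ 0 < s x ∧ I f x ≤ I f e)

/-- The remaining labels strictly between `e` and `f`. -/
def RPart (s : ℕ → ℕ) (I : ℕ → ℕ → ℕ) (e f x : ℕ) : Prop :=
  e < x ∧ x < f ∧ (s x = 0 ∨ I f e < I f x)

/-- The maximal inversion function not containing the ascent `(e,f)` of `I`. -/
noncomputable def avoidInv (s : ℕ → ℕ) (I : ℕ → ℕ → ℕ) (e f : ℕ) : ℕ → ℕ → ℕ := fun y x =>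
  if y = f ∧ LPart s I e f x then I f e
  else if RPart s I e f y ∧ LPart s I e f x then 0 else s y

section Avoid

variable {n : ℕ} {s : ℕ → ℕ} {I : ℕ → ℕ → ℕ} {e f : ℕ}

theorem avoid_trans (hI : GoodInv n s I) (hef : e < f) :
    IsTransitiveInv (avoidInv s I e f) := by
  intro x y z hxy hyz
  have := hI.le f e
  have hz : ∀ z, z = f → s z = s f := fun z h => by rw [h]
  have := hz z
  have := hz y
  unfold avoidInv LPart RPart
  split_ifs <;> omega

theorem avoid_good (hI : GoodInv n s I) (hef : e < f) : GoodInv n s (avoidInv s I e f) where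
  le := by
    intro y x
    have := hI.le f e
    unfold avoidInv
    split_ifs with h1 h2
    · rw [h1.1]; exact this
    · omega
    · omega
  tr := fun x y z _ h2 h3 _ => avoid_trans hI hef x y z h2 h3
  pl := by
    intro x y z _ hxy hyz _
    have := hI.le f e
    have hz : ∀ z, z = f → s z = s f := fun z h => by rw [h]
    have := hz z
    have := hz y
    unfold avoidInv LPart RPart
    split_ifs <;> omega

theorem le_avoid (hI : GoodInv n s I) (h : AscInv n s I e f) {x y : ℕ} (hx : 1 ≤ x)
    (hxy : x < y) : I y x ≤ avoidInv s I e f y x := by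
  have he := h.pos
  have hf := h.le
  unfold avoidInv
  split_ifs with h1 h2
  · obtain ⟨rfl, rfl | h1⟩ := h1
    · exact le_rfl
    · exact h1.2.2.2
  · obtain ⟨⟨a1, a2, a3⟩, h2⟩ := h2
    have := hI.le y x
    have t := hI.tr x y f hx hxy a2 hf
    rcases h2 with rfl | h2 <;> omega
  · exact hI.le y x

theorem lt_avoid (hI : GoodInv n s I) (h : AscInv n s I e f) {a b : ℕ} (h' : AscInv n s I a b)
    (hne : a ≠ e) : min (I b a + 1) (s b) ≤ avoidInv s I e f b a := by
  have he := h.pos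
  have hf := h.le
  have ha := h'.pos
  have hab := h'.lt
  unfold avoidInv
  split_ifs with h1 h2
  · obtain ⟨rfl, h1 | ⟨h1, h2, h3, h4⟩⟩ := h1
    · exact absurd h1 hne
    · have hlt : I b a ≠ I b e := by
        intro heq
        by_cases hd : DescInv n I e a
        · exact h'.leaf h3 e he h1 hd (h.mid a h1 h2 hd)
        · obtain ⟨z, k1, k2, k3, k4, k5⟩ := hI.meet he h1 hd
          rcases lt_trichotomy z b with hz | hz | hz
          · rw [h.mid z (by omega) hz k4, h'.mid z k1 hz k5] at k3
            exact k3 rfl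
          · rw [hz] at k3; exact k3 heq.symm
          · exact k3 ((h.desc z hz k2).trans (h'.desc z hz k2).symm)
      omega
  · obtain ⟨⟨a1, a2, a3⟩, h2⟩ := h2
    have hd := h'.desc f a2 hf
    rcases h2 with h2 | h2
    · exact absurd h2 hne
    · omega
  · omega

theorem avoid_self : avoidInv s I e f f e = I f e := by
  unfold avoidInv
  rw [if_pos ⟨rfl, Or.inl rfl⟩]

end Avoid

/-! ### Transitive closure -/

theorem tcInv_le {I J : ℕ → ℕ → ℕ} (hJ : IsTransitiveInv J) (h : ∀ y x, I y x ≤ J y x)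
    (y x : ℕ) : tcInv I y x ≤ J y x :=
  Nat.sInf_le ⟨J, hJ, h, rfl⟩

theorem le_tcInv {I J : ℕ → ℕ → ℕ} (hJ : IsTransitiveInv J) (h : ∀ y x, I y x ≤ J y x)
    (y x : ℕ) : I y x ≤ tcInv I y x := by
  have hne : {m | ∃ J : ℕ → ℕ → ℕ, IsTransitiveInv J ∧ (∀ y' x', I y' x' ≤ J y' x') ∧
      J y x = m}.Nonempty := ⟨_, J, hJ, h, rfl⟩
  obtain ⟨J', _, h2, h3⟩ := Nat.sInf_mem hne
  have := h2 y x
  unfold tcInv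
  omega

namespace SDecTree

variable {n : ℕ} {s : ℕ → ℕ}

/-- A rotation is below any transitive function containing `inv T + (b,a)`. -/
theorem IsRotation.le {T Z : SDecTree n s} {a b : ℕ} (hZ : IsRotation T Z a b)
    {J : ℕ → ℕ → ℕ} (hJ : IsTransitiveInv J) (h : ∀ y x, T.card y x ≤ J y x)
    (hab : min (T.card b a + 1) (s b) ≤ J b a) (y x : ℕ) : Z.card y x ≤ J y x := by
  by_cases hr : 1 ≤ x ∧ x < y ∧ y ≤ n
  · rw [hZ.2 y x hr.1 hr.2.1 hr.2.2]
    apply tcInv_le hJ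
    intro y x
    unfold addInv
    split_ifs with hh
    · obtain ⟨rfl, rfl⟩ := hh
      exact hab
    · exact h y x
  · rw [card_out hr]; omega

theorem IsRotation.add_le {T Z : SDecTree n s} {a b : ℕ} (hZ : IsRotation T Z a b)
    {y x : ℕ} (h1 : 1 ≤ x) (h2 : x < y) (h3 : y ≤ n) :
    addInv s T.card b a y x ≤ Z.card y x := by
  rw [hZ.2 y x h1 h2 h3]
  refine le_tcInv (J := fun y _ => s y) (fun a b c _ _ => Or.inr le_rfl) ?_ y x
  intro y x
  unfold addInv
  split_ifs
  · exact min_le_right _ _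
  · exact T.card_le y x

theorem IsRotation.wle {T Z : SDecTree n s} {a b : ℕ} (hZ : IsRotation T Z a b) :
    SDecTree.wle T Z := by
  intro y x
  by_cases hr : 1 ≤ x ∧ x < y ∧ y ≤ n
  · refine le_trans ?_ (hZ.add_le hr.1 hr.2.1 hr.2.2)
    have := T.card_le y x
    unfold addInv
    split_ifs <;> omega
  · rw [card_out hr]; omega

theorem IsRotation.card_lt {T Z : SDecTree n s} {a b : ℕ} (hZ : IsRotation T Z a b) :
    T.card b a < Z.card b a := by
  have h := (ascent_iff T a b).1 hZ.1
  have h1 := hZ.add_le h.pos h.lt h.le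
  have h2 := h.card
  unfold addInv at h1
  rw [if_pos ⟨rfl, rfl⟩] at h1
  omega

theorem IsRotation.wlt {T Z : SDecTree n s} {a b : ℕ} (hZ : IsRotation T Z a b) :
    SDecTree.wlt T Z :=
  ⟨hZ.wle, fun h => by
    have := h b a
    have := hZ.card_lt
    omega⟩

/-- A tree above `T` with one more inversion at `(b,a)` is above the rotation. -/
theorem IsRotation.wle_of {T Z U : SDecTree n s} {a b : ℕ} (hZ : IsRotation T Z a b)
    (hTU : SDecTree.wle T U) (h : T.card b a < U.card b a) : SDecTree.wle Z U := by
  intro y x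
  exact hZ.le U.card_trans hTU (by omega) y x

/-- A rotation at another ascent is below the avoiding function. -/
theorem IsRotation.le_avoid {T Z : SDecTree n s} {a b e f : ℕ} (hZ : IsRotation T Z a b)
    (h : AscInv n s T.card e f) (hne : a ≠ e) (y x : ℕ) :
    Z.card y x ≤ avoidInv s T.card e f y x := by
  refine hZ.le (avoid_trans T.card_good h.lt) ?_
    (lt_avoid T.card_good h ((ascent_iff T a b).1 hZ.1) hne) y x
  intro y x
  by_cases hr : 1 ≤ x ∧ x < y ∧ y ≤ n
  · exact _root_.le_avoid T.card_good h hr.1 hr.2.1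
  · rw [card_out hr]; omega

theorem exists_ascent_of_wlt {T U : SDecTree n s} (h : SDecTree.wlt T U) :
    ∃ e f, AscInv n s T.card e f ∧ T.card f e < U.card f e := by
  refine exists_ascent T.card_good U.card_good h.1 ?_
  have h2 := h.2
  unfold SDecTree.wle at h2
  push Not at h2
  obtain ⟨y, x, hyx⟩ := h2
  by_cases hr : 1 ≤ x ∧ x < y ∧ y ≤ n
  · exact ⟨y, x, hr.1, hr.2.1, hr.2.2, hyx⟩
  · rw [card_out hr, card_out hr] at hyx; omega

theorem IsRotation.wcov {T Z : SDecTree n s} {a b : ℕ} (hZ : IsRotation T Z a b) :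
    SDecTree.wcov T Z := by
  refine ⟨hZ.wlt, ?_⟩
  intro U h1 h2
  obtain ⟨e, f, h3, h4⟩ := exists_ascent_of_wlt h1
  by_cases hae : a = e
  · subst hae
    have := h3.uniq ((ascent_iff T a b).1 hZ.1)
    subst this
    exact h2.2 (hZ.wle_of h1.1 h4)
  · have := hZ.le_avoid h3 hae f e
    rw [avoid_self] at this
    have := h2.1 f e
    omega

/-- A cover above a rotation is the rotation. -/
theorem IsRotation.eq_of_cov {T Z U : SDecTree n s} {a b : ℕ} (hZ : IsRotation T Z a b)
    (hU : SDecTree.wcov T U) (h : SDecTree.wle Z U) : U = Z := by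
  by_cases h' : SDecTree.wle U Z
  · exact wle_antisymm h' h
  · exact (hU.2 Z hZ.wlt ⟨h, h'⟩).elim

end SDecTree

/-- `Z` and `Q` are the only atoms of the interval `[T, Z ∨ Q]` in the
`s`-weak order. -/
theorem no_other_atoms (n : ℕ) (s : ℕ → ℕ) (T Z Q W : SDecTree n s)
    (a b c d : ℕ) (hac : a < c)
    (hZ : SDecTree.IsRotation T Z a b) (hQ : SDecTree.IsRotation T Q c d)
    (hW : SDecTree.IsJoin Z Q W) :
    ∀ U : SDecTree n s, (SDecTree.wcov T U ∧ SDecTree.wle U W) ↔ (U = Z ∨ U = Q) := by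
  intro U
  constructor
  · rintro ⟨hU, hUW⟩
    obtain ⟨e, f, h3, h4⟩ := SDecTree.exists_ascent_of_wlt hU.1
    by_cases hae : a = e
    · subst hae
      have := h3.uniq ((ascent_iff T a b).1 hZ.1)
      subst this
      exact Or.inl (hZ.eq_of_cov hU (hZ.wle_of hU.1.1 h4))
    by_cases hce : c = e
    · subst hce
      have := h3.uniq ((ascent_iff T c d).1 hQ.1)
      subst this
      exact Or.inr (hQ.eq_of_cov hU (hQ.wle_of hU.1.1 h4))
    exfalso
    have hg := avoid_good T.card_good h3.lt
    have hle : ∀ A : SDecTree n s, (∀ y x, A.card y x ≤ avoidInv s T.card e f y x) →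
        SDecTree.wle A (buildTree hg) := by
      intro A hA y x
      by_cases hr : 1 ≤ x ∧ x < y ∧ y ≤ n
      · rw [build_card hg hr.1 hr.2.1 hr.2.2]; exact hA y x
      · rw [SDecTree.card_out hr]; omega
    have h5 := hW.2.2 _ (hle Z (hZ.le_avoid h3 hae)) (hle Q (hQ.le_avoid h3 hce)) f e
    rw [build_card hg h3.pos h3.lt h3.le, avoid_self] at h5
    have := hUW f e
    omega
  · rintro (rfl | rfl)
    · exact ⟨hZ.wcov, hW.1⟩
    · exact ⟨hQ.wcov, hW.2.1⟩
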